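/- Let k be an algebraically closed field of characteristic p > 0 and let R be an algebroid curve over k whose integral closure R̄ in Frac(R) is a finitely generated R-module. Then: (i) the quadratic transform satisfies R₁ = R if and only if R is regular; (ii) the chain R ⊆ R₁ ⊆ R₂ ⊆ … of iterated quadratic transforms is eventually constant and reaches R̄, i.e. there exists i with R_i = R̄; in particular M(R) is a well-defined natural number, with M(R) = 0 exactly when R is regular. -/

import Mathlib

/-! Algebroid curves over `k`, realized as `k`-subalgebras `R` of an ambient field
`F` (which is assumed to be the fraction field of `R`), together with quadratic
transforms, the integral closure `R̄`, and the invariant `M(R)`. -/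

noncomputable section
namespace Zhukov

variable {k F : Type} [Field k] [Field F] [Algebra k F]

/-- The set of nonunits of the (local) ring `R`. -/
def nonunitsIn (R : Subalgebra k F) : Set F := {x | x ∈ R ∧ ∀ y ∈ R, x * y ≠ 1}

/-- `x` is a transversal parameter of `R`: a nonzero nonunit whose valuation is
minimal, i.e. such that `z/x` is integral over `R` for every nonunit `z` of `R`
(the integral closure of `R` in `Frac R` being the valuation ring). -/
def IsTransv (R : Subalgebra k F) (x : F) : Prop :=
  x ∈ nonunitsIn R ∧ x ≠ 0 ∧
    ∀ z ∈ nonunitsIn R, ∃ w : F, w * x = z ∧ IsIntegral R w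

/-- The quadratic transform `R₁ = R[x⁻¹ m_R]`, `x` a transversal parameter
(the result is independent of the choice of `x`, so we adjoin the quotients for all
transversal parameters). -/
def quadT (R : Subalgebra k F) : Subalgebra k F :=
  Algebra.adjoin k ((R : Set F) ∪
    {w | ∃ x z, IsTransv R x ∧ z ∈ nonunitsIn R ∧ w * x = z})

/-- Iterated quadratic transforms `R ⊆ R₁ ⊆ R₂ ⊆ …`. -/
def quadIter (R : Subalgebra k F) : ℕ → Subalgebra k F
  | 0 => R
  | n + 1 => quadT (quadIter R n)

/-- The integral closure `R̄` of `R` in its fraction field `Frac R ⊆ F`. -/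
def intCl (R : Subalgebra k F) : Set F :=
  {w | IsIntegral R w ∧ ∃ a ∈ R, ∃ b ∈ R, b ≠ 0 ∧ w * b = a}

/-- `M(R)`: the least `i` with `R_i = R̄`. -/
def Mnum (R : Subalgebra k F) : ℕ :=
  sInf {i : ℕ | (quadIter R i : Set F) = intCl R}

/-- `R` is an algebroid curve over `k`: a complete Noetherian one-dimensional local
domain with coefficient field `k` (the domain property holds automatically for a
subring of the field `F`). -/
def IsAlgebroidCurve (R : Subalgebra k F) : Prop :=
  IsNoetherianRing R ∧ IsLocalRing R ∧ ringKrullDim R = 1 ∧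
    ∀ _h : IsLocalRing R,
      IsAdicComplete (IsLocalRing.maximalIdeal R) R ∧
      Function.Bijective ((IsLocalRing.residue R).comp (algebraMap k R))

/-- `F` is the fraction field of `R`. -/
def IsFracOf (R : Subalgebra k F) : Prop :=
  ∀ w : F, ∃ a ∈ R, ∃ b ∈ R, b ≠ 0 ∧ w * b = a

/-- The integral closure `R̄` is a finitely generated `R`-module. -/
def BarFinite (R : Subalgebra k F) : Prop :=
  ∃ s : Finset F, (↑s : Set F) ⊆ intCl R ∧
    intCl R ⊆ (Submodule.span R (↑s : Set F) : Set F)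


section Helpers

open Polynomial in
theorem local_of_complete_dedekind {A : Type*} [CommRing A] [IsDedekindDomain A]
    (I : Ideal A) (hI : I ≠ ⊥) [IsAdicComplete I A] : IsLocalRing A := by
  have hjac := IsAdicComplete.le_jacobson_bot I
  have hle : ∀ P : Ideal A, P.IsMaximal → I ≤ P := fun P hP =>
    hjac.trans (sInf_le ⟨bot_le, hP⟩)
  obtain ⟨P, hP⟩ := Ideal.exists_maximal A
  refine IsLocalRing.of_unique_max_ideal ⟨P, hP, fun Q hQ => ?_⟩
  by_contra hne
  have hP0 : P ≠ ⊥ := fun h => hI (le_bot_iff.mp (h ▸ hle P hP))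
  have hPp : Prime P := Ideal.prime_of_isPrime hP0 hP.isPrime
  obtain ⟨J, hJ, hPJ⟩ :=
    (FiniteMultiplicity.of_prime_left hPp hI).exists_eq_pow_mul_and_not_dvd
  set n := multiplicity P I
  have hn : n ≠ 0 := by
    intro h
    rw [h, pow_zero, one_mul] at hJ
    exact hPJ (hJ ▸ Ideal.dvd_iff_le.mpr (hle P hP))
  have hJQ : J ≤ Q := by
    have h1 : P ^ n * J ≤ Q := hJ ▸ hle Q hQ
    rcases (hQ.isPrime.mul_le).mp h1 with h | h
    · exact absurd (hP.eq_of_le hQ.ne_top (hQ.isPrime.le_of_pow_le h)).symm hne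
    · exact h
  have hcop : P ^ n ⊔ J = ⊤ := by
    apply Ideal.isCoprime_iff_sup_eq.mp
    apply IsCoprime.pow_left
    rw [Ideal.isCoprime_iff_sup_eq]
    by_contra h
    exact hPJ (Ideal.dvd_iff_le.mpr ((le_sup_right : J ≤ P ⊔ J).trans
      (hP.eq_of_le h le_sup_left).ge))
  have h1 : (1 : A) ∈ P ^ n ⊔ J := hcop ▸ Submodule.mem_top
  obtain ⟨e, he, f, hf, hef⟩ := Submodule.mem_sup.mp h1
  have hefI : e * f ∈ I := hJ ▸ Ideal.mul_mem_mul he hf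
  have hfe : f = 1 - e := by rw [← hef]; ring
  have hmon : (X ^ 2 - X : A[X]).Monic := by monicity!
  obtain ⟨a, ha, hae⟩ := HenselianRing.is_henselian (I := I) (X ^ 2 - X : A[X]) hmon e
    (by
      have : eval e (X ^ 2 - X : A[X]) = -(e * f) := by simp [hfe]; ring
      rw [this]; exact I.neg_mem hefI)
    (by
      have h2 : eval e (derivative (X ^ 2 - X : A[X])) = 2 * e - 1 := by simp; norm_num
      rw [h2]
      apply IsUnit.of_mul_eq_one (Ideal.Quotient.mk I (2 * e - 1))
      rw [← map_mul, ← map_one (Ideal.Quotient.mk I), Ideal.Quotient.eq]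
      have : (2 * e - 1) * (2 * e - 1) - 1 = -4 * (e * f) := by rw [hfe]; ring
      rw [this]; exact I.mul_mem_left _ hefI)
  have ha' : a * (a - 1) = 0 := by
    have : a ^ 2 - a = 0 := by simpa [IsRoot] using ha
    linear_combination this
  rcases mul_eq_zero.mp ha' with h0 | h0
  · have heQ : e ∈ Q := hle Q hQ (by simpa [h0] using I.neg_mem hae)
    exact hQ.ne_top ((Ideal.eq_top_iff_one _).mpr (hef ▸ Q.add_mem heQ (hJQ hf)))
  · have hfP : f ∈ P := hle P hP (by
      rw [hfe, ← sub_eq_zero.mp h0]; exact hae)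
    exact hP.ne_top ((Ideal.eq_top_iff_one _).mpr
      (hef ▸ P.add_mem (Ideal.pow_le_self hn he) hfP))

open TensorProduct in
theorem adicComplete_of_finite {R M : Type*} [CommRing R] [IsNoetherianRing R] [IsLocalRing R]
    [AddCommGroup M] [Module R M] [Module.Finite R M]
    [IsAdicComplete (IsLocalRing.maximalIdeal R) R] :
    IsAdicComplete (IsLocalRing.maximalIdeal R) M := by
  have : IsPrecomplete (IsLocalRing.maximalIdeal R) M := by
    rw [← AdicCompletion.of_surjective_iff]
    intro y
    obtain ⟨t, rfl⟩ := AdicCompletion.ofTensorProduct_surjective_of_finite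
      (IsLocalRing.maximalIdeal R) M y
    induction t with
    | zero => exact ⟨0, by simp⟩
    | add a b ha hb =>
      obtain ⟨a', ha⟩ := ha
      obtain ⟨b', hb⟩ := hb
      exact ⟨a' + b', by simp [ha, hb]⟩
    | tmul r m =>
      obtain ⟨r, rfl⟩ := AdicCompletion.of_surjective (IsLocalRing.maximalIdeal R) R r
      refine ⟨r • m, ?_⟩
      rw [AdicCompletion.ofTensorProduct_tmul]
      rw [map_smul]
      ext n
      rfl
  exact { }

variable {R S : Subalgebra k F}

theorem isFractionRing_of (hfrac : IsFracOf R) : IsFractionRing R F := by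
  apply IsFractionRing.of_field
  intro z
  obtain ⟨a, ha, b, hb, hb0, h⟩ := hfrac z
  exact ⟨⟨a, ha⟩, ⟨b, hb⟩, by
    show z = a / b
    rw [eq_div_iff hb0, h]⟩

theorem mem_intCl (hfrac : IsFracOf R) (w : F) : w ∈ intCl R ↔ IsIntegral R w :=
  ⟨fun h => h.1, fun h => ⟨h, hfrac w⟩⟩

theorem finite_bar (hfrac : IsFracOf R) (hfin : BarFinite R) :
    Module.Finite R (integralClosure R F) := by
  obtain ⟨s, hs1, hs2⟩ := hfin
  have : Subalgebra.toSubmodule (integralClosure R F) = Submodule.span R (↑s : Set F) := by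
    apply le_antisymm
    · intro w hw
      exact hs2 ((mem_intCl hfrac w).mpr hw)
    · rw [Submodule.span_le]
      intro w hw
      exact (hs1 hw).1
  have hfg : (Subalgebra.toSubmodule (integralClosure R F)).FG := ⟨s, this.symm⟩
  exact Module.Finite.iff_fg.mpr hfg

theorem dvr_bar [IsNoetherianRing R] [IsLocalRing R] (hdim : ringKrullDim R = 1)
    [IsAdicComplete (IsLocalRing.maximalIdeal R) R] (hfrac : IsFracOf R) (hfin : BarFinite R) :
    ¬ IsField R ∧ IsDiscreteValuationRing (integralClosure R F) := by
  have := isFractionRing_of hfrac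
  have := finite_bar hfrac hfin
  have hnf : ¬ IsField R := by
    intro h
    rw [ringKrullDim_eq_zero_of_isField h] at hdim
    exact zero_ne_one hdim
  have : Ring.KrullDimLE 1 R := Ring.krullDimLE_iff.mpr hdim.le
  have : Ring.DimensionLEOne R := ⟨fun {P} h0 hP =>
    Ring.krullDimLE_one_iff_of_isPrime_bot.mp this P h0 hP⟩
  have hinj : Function.Injective (algebraMap R (integralClosure R F)) :=
    fun _ _ h => Subtype.ext (Subtype.ext_iff.mp h :)
  have : IsNoetherianRing (integralClosure R F) := isNoetherian_of_tower R inferInstance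
  have : IsIntegrallyClosed (integralClosure R F) :=
    integralClosure.isIntegrallyClosedOfFiniteExtension F
  have : IsDedekindDomain (integralClosure R F) := { }
  have : IsAdicComplete (IsLocalRing.maximalIdeal R) (integralClosure R F) :=
    adicComplete_of_finite
  have : IsAdicComplete ((IsLocalRing.maximalIdeal R).map
    (algebraMap R (integralClosure R F))) (integralClosure R F) :=
    (IsAdicComplete.map_algebraMap_iff ..).mpr this
  have : IsLocalRing (integralClosure R F) := by
    refine local_of_complete_dedekind ((IsLocalRing.maximalIdeal R).map
      (algebraMap R (integralClosure R F))) ?_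
    intro h
    rw [Ideal.map_eq_bot_iff_of_injective hinj] at h
    exact hnf (IsLocalRing.isField_iff_maximalIdeal_eq.mpr h)
  have hnf' : ¬ IsField (integralClosure R F) := fun h =>
    hnf (isField_of_isIntegral_of_isField hinj h)
  exact ⟨hnf, ((IsDiscreteValuationRing.TFAE (integralClosure R F) hnf').out 0 2).mpr ‹_›⟩

theorem isIntegral_of_le (hRS : R ≤ S) {w : F} (h : IsIntegral R w) : IsIntegral S w := by
  let : Algebra R S := (Subalgebra.inclusion hRS).toAlgebra
  have : IsScalarTower R S F := IsScalarTower.of_algebraMap_eq fun _ => rfl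
  exact h.tower_top

theorem isIntegral_down (hRS : R ≤ S) (hS : ∀ x ∈ S, IsIntegral R x) {w : F}
    (h : IsIntegral S w) : IsIntegral R w := by
  let : Algebra R S := (Subalgebra.inclusion hRS).toAlgebra
  have : IsScalarTower R S F := IsScalarTower.of_algebraMap_eq fun _ => rfl
  have : Algebra.IsIntegral R S := ⟨fun x =>
    (isIntegral_algebraMap_iff (FaithfulSMul.algebraMap_injective S F)).mp (hS x x.2)⟩
  exact isIntegral_trans w h

theorem mem_nonunitsIn (x : S) : (x : F) ∈ nonunitsIn S ↔ x ∈ nonunits S := by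
  constructor
  · rintro ⟨-, h⟩ hu
    obtain ⟨y, hy⟩ := hu.exists_right_inv
    exact h y y.2 (by exact_mod_cast congrArg Subtype.val hy)
  · refine fun h => ⟨x.2, fun y hy hxy => h ?_⟩
    exact IsUnit.of_mul_eq_one (⟨y, hy⟩ : S) (Subtype.ext hxy)

theorem good_props [IsNoetherianRing R] (hnf : ¬ IsField R)
    [Module.Finite R (integralClosure R F)] [IsLocalRing (integralClosure R F)]
    (hRS : R ≤ S) (hS : ∀ x ∈ S, IsIntegral R x) :
    IsNoetherianRing S ∧ IsLocalRing S ∧ ¬ IsField S := by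
  let : Algebra R S := (Subalgebra.inclusion hRS).toAlgebra
  have : IsScalarTower R S F := IsScalarTower.of_algebraMap_eq fun _ => rfl
  have : Algebra.IsIntegral R S := ⟨fun x =>
    (isIntegral_algebraMap_iff (FaithfulSMul.algebraMap_injective S F)).mp (hS x x.2)⟩
  let f : S →ₐ[R] integralClosure R F :=
    (IsScalarTower.toAlgHom R S F).codRestrict _ fun x => hS x x.2
  have hf : Function.Injective f := fun a b h => Subtype.ext (Subtype.ext_iff.mp h :)
  refine ⟨?_, ?_, ?_⟩
  · have : IsNoetherian R S := isNoetherian_of_injective f.toLinearMap hf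
    exact isNoetherian_of_tower R this
  · have hint : (f : S →+* integralClosure R F).IsIntegral := by
      intro a
      have h1 : (algebraMap R (integralClosure R F)).IsIntegralElem a :=
        Algebra.IsIntegral.isIntegral (R := R) a
      have h2 : algebraMap R (integralClosure R F) =
        (f : S →+* integralClosure R F).comp (algebraMap R S) := by
        ext; rfl
      rw [h2] at h1
      exact RingHom.IsIntegralElem.of_comp h1
    have := hint.isLocalHom hf
    exact RingHom.domain_isLocalRing (f : S →+* integralClosure R F)
  · intro h
    refine hnf (isField_of_isIntegral_of_isField (R := R) (S := S) ?_ h)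
    exact fun a b h => Subtype.ext (Subtype.ext_iff.mp h :)

theorem exists_transv [IsDiscreteValuationRing (integralClosure R F)] [IsLocalRing S]
    (hRS : R ≤ S) (hS : ∀ x ∈ S, IsIntegral R x) (hnf : ¬ IsField S) :
    ∃ x, IsTransv S x := by
  classical
  have hne : ∃ x : S, x ≠ 0 ∧ x ∈ nonunits S := by
    by_contra! h
    refine hnf (IsLocalRing.isField_iff_maximalIdeal_eq.mpr ?_)
    rw [eq_bot_iff]
    intro x hx
    by_contra h0
    exact h x h0 hx
  let T : Set S := {x | x ≠ 0 ∧ x ∈ nonunits S}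
  let v : S → ℕ∞ := fun x =>
    IsDiscreteValuationRing.addVal (integralClosure R F) ⟨x, hS x x.2⟩
  obtain ⟨x, hx, hmin⟩ := exists_minimalFor_of_wellFoundedLT (fun x => x ∈ T) v hne
  refine ⟨x, (mem_nonunitsIn x).mpr hx.2, by simpa using hx.1, ?_⟩
  intro z hz
  by_cases hz0 : z = 0
  · exact ⟨0, by simp [hz0], isIntegral_zero⟩
  have hzT : (⟨z, hz.1⟩ : S) ∈ T :=
    ⟨fun h => hz0 (congrArg Subtype.val h), (mem_nonunitsIn _).mp hz⟩
  have hle : v x ≤ v ⟨z, hz.1⟩ := by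
    rcases le_total (v x) (v ⟨z, hz.1⟩) with h | h
    · exact h
    · exact hmin hzT h
  obtain ⟨w, hw⟩ := IsDiscreteValuationRing.addVal_le_iff_dvd.mp hle
  refine ⟨w, ?_, isIntegral_of_le hRS w.2⟩
  have := congrArg Subtype.val hw
  rw [mul_comm]
  exact this.symm

theorem le_quadT : S ≤ quadT S := fun _ hx => Algebra.subset_adjoin (Or.inl hx)

theorem quadT_integral (hRS : R ≤ S) (hS : ∀ x ∈ S, IsIntegral R x) :
    ∀ x ∈ quadT S, IsIntegral R x := by
  have : quadT S ≤ (integralClosure R F).restrictScalars k := by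
    refine Algebra.adjoin_le ?_
    rintro w (hw | ⟨x, z, hx, hz, hw⟩)
    · exact hS w hw
    · obtain ⟨w', hw', hi⟩ := hx.2.2 z hz
      have : w = w' := mul_right_cancel₀ hx.2.1 (hw.trans hw'.symm)
      exact this ▸ isIntegral_down hRS hS hi
  exact this

theorem principal_of_quadT [IsLocalRing S] (h : quadT S ≤ S) (hx : ∃ x, IsTransv S x) :
    (IsLocalRing.maximalIdeal S).IsPrincipal := by
  obtain ⟨x, hx⟩ := hx
  refine ⟨⟨⟨x, hx.1.1⟩, ?_⟩⟩
  apply le_antisymm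
  · intro z hz
    have hz' : (z : F) ∈ nonunitsIn S := (mem_nonunitsIn z).mpr hz
    obtain ⟨w, hw, -⟩ := hx.2.2 z hz'
    have hwS : w ∈ S := h (Algebra.subset_adjoin (Or.inr ⟨x, z, hx, hz', hw⟩))
    exact Ideal.mem_span_singleton'.mpr ⟨⟨w, hwS⟩, Subtype.ext hw⟩
  · refine (Ideal.span_singleton_le_iff_mem _).mpr ?_
    exact (mem_nonunitsIn (⟨x, hx.1.1⟩ : S)).mp hx.1

theorem closed_iff_principal [IsNoetherianRing S] [IsLocalRing S] (hS : IsFracOf S)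
    (hd : Ring.DimensionLEOne S) (hnf : ¬ IsField S) :
    (∀ w : F, IsIntegral S w → w ∈ S) ↔ (IsLocalRing.maximalIdeal S).IsPrincipal := by
  have := isFractionRing_of hS
  have e1 : (∀ w : F, IsIntegral S w → w ∈ S) ↔ IsIntegrallyClosed S := by
    rw [isIntegrallyClosed_iff F]
    constructor
    · exact fun h w hw => ⟨⟨w, h w hw⟩, rfl⟩
    · intro h w hw
      obtain ⟨y, rfl⟩ := h hw
      exact y.2
  rw [e1]
  have T := IsDiscreteValuationRing.TFAE S hnf
  constructor
  · intro h
    have : IsDedekindDomain S := { }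
    exact (T.out 2 4).mp this
  · intro h
    have : IsDedekindDomain S := (T.out 2 4).mpr h
    infer_instance

end Helpers

end Zhukov

open Zhukov in
/-- basic properties of quadratic transforms: for an algebroid
curve `R` over `k` (algebraically closed of characteristic `p > 0`) with finite
integral closure:
(i) `R₁ = R` iff `R` is regular (equivalently, for a one-dimensional Noetherian
local domain: the maximal ideal is principal);
(ii) the chain of iterated quadratic transforms reaches `R̄`, i.e. `∃ i, R_i = R̄`;
in particular `M(R)` is well defined, and `M(R) = 0` exactly when `R` is regular. -/
theorem statement11 (k F : Type) [Field k] [Field F] [Algebra k F]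
    [IsAlgClosed k] (p : ℕ) [CharP k p] (hp : p.Prime)
    (R : Subalgebra k F)
    (hR : IsAlgebroidCurve R) (hfrac : IsFracOf R) (hfin : BarFinite R) :
    (∃ i : ℕ, (quadIter R i : Set F) = intCl R) ∧
    ∀ _h : IsLocalRing R,
      (quadT R = R ↔ (IsLocalRing.maximalIdeal R).IsPrincipal) ∧
      (Mnum R = 0 ↔ (IsLocalRing.maximalIdeal R).IsPrincipal) := by
  obtain ⟨hN, hL, hdim, hcomp⟩ := hR
  obtain ⟨hcomp, -⟩ := hcomp hL
  obtain ⟨hnf, hdvr⟩ := dvr_bar hdim hfrac hfin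
  have hfinA := finite_bar hfrac hfin
  have hdR : Ring.DimensionLEOne R := ⟨fun {P} h0 hP =>
    Ring.krullDimLE_one_iff_of_isPrime_bot.mp (Ring.krullDimLE_iff.mpr hdim.le) P h0 hP⟩
  have hRR : ∀ x ∈ R, IsIntegral R x := fun x hx =>
    isIntegral_algebraMap (x := (⟨x, hx⟩ : R))
  have key : ∀ S : Subalgebra k F, R ≤ S → (∀ x ∈ S, IsIntegral R x) →
      quadT S ≤ S → ∀ w : F, IsIntegral R w → w ∈ S := by
    intro S hRS hS hq w hw
    obtain ⟨h1, h2, h3⟩ := good_props hnf hRS hS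
    have hd : Ring.DimensionLEOne S := by
      let : Algebra R S := (Subalgebra.inclusion hRS).toAlgebra
      have : IsScalarTower R S F := IsScalarTower.of_algebraMap_eq fun _ => rfl
      have : Algebra.IsIntegral R S := ⟨fun x =>
        (isIntegral_algebraMap_iff (FaithfulSMul.algebraMap_injective S F)).mp (hS x x.2)⟩
      exact Ring.DimensionLEOne.of_isIntegral R S
    have hfS : IsFracOf S := fun w => by
      obtain ⟨a, ha, b, hb, h⟩ := hfrac w
      exact ⟨a, hRS ha, b, hRS hb, h⟩
    exact (closed_iff_principal hfS hd h3).mpr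
      (principal_of_quadT hq (exists_transv hRS hS h3)) w (isIntegral_of_le hRS hw)
  have hiter : ∀ n, R ≤ quadIter R n ∧ ∀ x ∈ quadIter R n, IsIntegral R x := by
    intro n
    induction n with
    | zero => exact ⟨le_rfl, hRR⟩
    | succ n ih => exact ⟨ih.1.trans le_quadT, quadT_integral ih.1 ih.2⟩
  have hex : ∃ i : ℕ, (quadIter R i : Set F) = intCl R := by
    have hNA : IsNoetherian R (integralClosure R F) := inferInstance
    let g : ℕ → Submodule R (integralClosure R F) := fun n =>
      { carrier := {x | (x : F) ∈ quadIter R n}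
        add_mem' := fun ha hb => (quadIter R n).add_mem ha hb
        zero_mem' := (quadIter R n).zero_mem
        smul_mem' := fun c _ hx => (quadIter R n).mul_mem ((hiter n).1 c.2) hx }
    have hg : Monotone g := monotone_nat_of_le_succ fun n x hx => le_quadT hx
    obtain ⟨n, hn⟩ := monotone_stabilizes_iff_noetherian.mpr hNA ⟨g, hg⟩
    refine ⟨n, ?_⟩
    have hq : quadT (quadIter R n) ≤ quadIter R n := by
      intro x hx
      have hx' : (⟨x, (hiter (n + 1)).2 x hx⟩ : integralClosure R F) ∈ g (n + 1) := hx
      have := hn (n + 1) n.le_succ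
      change g n = g (n + 1) at this
      rw [← this] at hx'
      exact hx'
    ext w
    rw [mem_intCl hfrac]
    exact ⟨(hiter n).2 w, key _ (hiter n).1 (hiter n).2 hq w⟩
  refine ⟨hex, fun _ => ?_⟩
  have hcl := closed_iff_principal hfrac hdR hnf
  refine ⟨?_, ?_⟩
  · rw [← hcl]
    constructor
    · exact fun h => key R le_rfl hRR h.le
    · exact fun h => le_antisymm (fun x hx => h x (quadT_integral le_rfl hRR x hx)) le_quadT
  · rw [← hcl, Mnum, Nat.sInf_eq_zero]
    constructor
    · rintro (h | h)
      · intro w hw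
        have h' : (R : Set F) = intCl R := h
        have : w ∈ (R : Set F) := h' ▸ (mem_intCl hfrac w).mpr hw
        exact this
      · obtain ⟨i, hi⟩ := hex
        exact absurd hi (Set.eq_empty_iff_forall_notMem.mp h i)
    · intro h
      left
      show (R : Set F) = intCl R
      ext w
      rw [mem_intCl hfrac]
      exact ⟨hRR w, h w⟩
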